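/- Let R be an associative ring with unit and let (A, B) be a hereditary complete cotorsion pair in Mod R with pd_A(A) < ∞. Set α := resdim_A(P), the A-resolution dimension of the class P of modules of finite projective dimension. Then α ≤ Findim(R) ≤ pd_A(A) + α, where Findim(R) denotes the big finitistic dimension of R. -/

import Mathlib

noncomputable section

open CategoryTheory CategoryTheory.Limits Opposite DirectSum

universe u

namespace CotorsionDim

variable {R : Type u} [Ring R]

/-- `Ext^n_R(M,N) = 0`. -/
def ExtZero (M N : ModuleCat.{u} R) (n : ℕ) : Prop :=
  IsZero (((Ext ℤ (ModuleCat.{u} R) n).obj (op M)).obj N)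

/-- A pair of composable maps forms a short exact sequence `0 → A → B → C → 0`. -/
def IsSES {A B C : ModuleCat.{u} R} (f : A ⟶ B) (g : B ⟶ C) : Prop :=
  ∃ w : f ≫ g = 0, (CategoryTheory.ShortComplex.mk f g w).ShortExact

/-- relative projective dimension `pd_𝒳(M)` -/
def rpd (𝒳 : Set (ModuleCat.{u} R)) (M : ModuleCat.{u} R) : ℕ∞ :=
  sInf {n : ℕ∞ | ∀ j : ℕ, n < (j : ℕ∞) → ∀ X ∈ 𝒳, ExtZero M X j}

/-- relative injective dimension `id_𝒳(M)` -/
def rid (𝒳 : Set (ModuleCat.{u} R)) (M : ModuleCat.{u} R) : ℕ∞ :=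
  sInf {n : ℕ∞ | ∀ j : ℕ, n < (j : ℕ∞) → ∀ X ∈ 𝒳, ExtZero X M j}

/-- `pd_𝒳(𝒴)` -/
def rpdClass (𝒳 𝒴 : Set (ModuleCat.{u} R)) : ℕ∞ := ⨆ Y : 𝒴, rpd 𝒳 Y

/-- `id_𝒳(𝒴)` -/
def ridClass (𝒳 𝒴 : Set (ModuleCat.{u} R)) : ℕ∞ := ⨆ Y : 𝒴, rid 𝒳 Y

/-- projective dimension -/
def pd (M : ModuleCat.{u} R) : ℕ∞ := rpd Set.univ M

/-- injective dimension -/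
def idim (M : ModuleCat.{u} R) : ℕ∞ := rid Set.univ M

/-- `pd(𝒴)` -/
def pdClass (𝒴 : Set (ModuleCat.{u} R)) : ℕ∞ := ⨆ Y : 𝒴, pd Y.1

/-- `id(𝒴)` -/
def idClass (𝒴 : Set (ModuleCat.{u} R)) : ℕ∞ := ⨆ Y : 𝒴, idim Y.1

/-- `M` has an `𝒳`-resolution `0 → X_n → ⋯ → X_0 → M → 0` of length `n`. -/
def HasResLen (𝒳 : Set (ModuleCat.{u} R)) : ℕ → ModuleCat.{u} R → Prop
  | 0, M => M ∈ 𝒳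
  | n+1, M => ∃ (K X : ModuleCat.{u} R) (f : K ⟶ X) (g : X ⟶ M),
      X ∈ 𝒳 ∧ IsSES f g ∧ HasResLen 𝒳 n K

/-- `M` has an `𝒳`-coresolution `0 → M → X_0 → ⋯ → X_n → 0` of length `n`. -/
def HasCoresLen (𝒳 : Set (ModuleCat.{u} R)) : ℕ → ModuleCat.{u} R → Prop
  | 0, M => M ∈ 𝒳
  | n+1, M => ∃ (X C : ModuleCat.{u} R) (f : M ⟶ X) (g : X ⟶ C),
      X ∈ 𝒳 ∧ IsSES f g ∧ HasCoresLen 𝒳 n C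

/-- `resdim_𝒳(M)` -/
def resdim (𝒳 : Set (ModuleCat.{u} R)) (M : ModuleCat.{u} R) : ℕ∞ :=
  ⨅ n : {n : ℕ // HasResLen 𝒳 n M}, (n : ℕ∞)

/-- `coresdim_𝒳(M)` -/
def coresdim (𝒳 : Set (ModuleCat.{u} R)) (M : ModuleCat.{u} R) : ℕ∞ :=
  ⨅ n : {n : ℕ // HasCoresLen 𝒳 n M}, (n : ℕ∞)

/-- `resdim_𝒳(𝒴)` -/
def resdimClass (𝒳 𝒴 : Set (ModuleCat.{u} R)) : ℕ∞ := ⨆ Y : 𝒴, resdim 𝒳 Y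

/-- `coresdim_𝒳(𝒴)` -/
def coresdimClass (𝒳 𝒴 : Set (ModuleCat.{u} R)) : ℕ∞ := ⨆ Y : 𝒴, coresdim 𝒳 Y

/-- `𝒳^∧`, the class of modules with a finite `𝒳`-resolution. -/
def resClosure (𝒳 : Set (ModuleCat.{u} R)) : Set (ModuleCat.{u} R) :=
  {M | ∃ n, HasResLen 𝒳 n M}

/-- `𝒳^∨`, the class of modules with a finite `𝒳`-coresolution. -/
def coresClosure (𝒳 : Set (ModuleCat.{u} R)) : Set (ModuleCat.{u} R) :=
  {M | ∃ n, HasCoresLen 𝒳 n M}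

/-- `(𝒜, ℬ)` is a cotorsion pair. -/
def IsCotorsionPair (𝒜 ℬ : Set (ModuleCat.{u} R)) : Prop :=
  (∀ M, M ∈ 𝒜 ↔ ∀ B ∈ ℬ, ExtZero M B 1) ∧
  (∀ M, M ∈ ℬ ↔ ∀ A ∈ 𝒜, ExtZero A M 1)

/-- completeness of a cotorsion pair -/
def IsComplete (𝒜 ℬ : Set (ModuleCat.{u} R)) : Prop :=
  ∀ M : ModuleCat.{u} R,
    (∃ (B A : ModuleCat.{u} R) (f : B ⟶ A) (g : A ⟶ M), B ∈ ℬ ∧ A ∈ 𝒜 ∧ IsSES f g) ∧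
    (∃ (B A : ModuleCat.{u} R) (f : M ⟶ B) (g : B ⟶ A), B ∈ ℬ ∧ A ∈ 𝒜 ∧ IsSES f g)

/-- heredity of a cotorsion pair -/
def IsHereditary (𝒜 ℬ : Set (ModuleCat.{u} R)) : Prop :=
  ∀ i : ℕ, 1 ≤ i → ∀ A ∈ 𝒜, ∀ B ∈ ℬ, ExtZero A B i

variable (R)

/-- `𝒫`, the class of modules of finite projective dimension. -/
def P : Set (ModuleCat.{u} R) := {M | pd M < ⊤}

variable {R}

/-- `M` admits a projective resolution consisting of finitely generated projectives,
i.e. `M ∈ mod R`. -/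
def InmodR (M : ModuleCat.{u} R) : Prop :=
  ∃ K : ℕ → ModuleCat.{u} R, K 0 = M ∧ ∀ i : ℕ,
    ∃ (Q : ModuleCat.{u} R) (f : K (i+1) ⟶ Q) (g : Q ⟶ K i),
      Module.Finite R Q ∧ Projective Q ∧ IsSES f g

variable (R)

/-- `𝒫^{<∞} = 𝒫 ∩ mod R`. -/
def Pfin : Set (ModuleCat.{u} R) := {M | pd M < ⊤ ∧ InmodR M}

/-- the big finitistic dimension -/
def bigFindim : ℕ∞ := pdClass (P R)

/-- the little finitistic dimension -/
def littleFindim : ℕ∞ := pdClass (Pfin R)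

variable {R}

/-- `𝒳^{⊥₁}` -/
def rperp1 (𝒳 : Set (ModuleCat.{u} R)) : Set (ModuleCat.{u} R) :=
  {M | ∀ X ∈ 𝒳, ExtZero X M 1}

/-- `^{⊥₁}𝒳` -/
def lperp1 (𝒳 : Set (ModuleCat.{u} R)) : Set (ModuleCat.{u} R) :=
  {M | ∀ X ∈ 𝒳, ExtZero M X 1}

/-- `T^⊥ = {M : Ext^i(T,M) = 0 for all i > 0}` -/
def rperpAll (T : ModuleCat.{u} R) : Set (ModuleCat.{u} R) :=
  {M | ∀ i : ℕ, 0 < i → ExtZero T M i}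

/-- `Add T`: direct summands of arbitrary direct sums of copies of `T`. -/
def AddT (T : ModuleCat.{u} R) : Set (ModuleCat.{u} R) :=
  {M | ∃ (I : Type u) (s : M ⟶ ModuleCat.of R (I →₀ T)) (r : ModuleCat.of R (I →₀ T) ⟶ M),
    s ≫ r = 𝟙 M}

/-- `T` is a tilting module. -/
def IsTilting (T : ModuleCat.{u} R) : Prop :=
  pd T < ⊤ ∧
  (∀ i : ℕ, 0 < i → ∀ I : Type u, ExtZero T (ModuleCat.of R (I →₀ T)) i) ∧
  ∃ n, HasCoresLen (AddT T) n (ModuleCat.of R R)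


/-- `𝒳` is closed under arbitrary direct sums (coproducts). -/
def ClosedUnderCoproducts (𝒳 : Set (ModuleCat.{u} R)) : Prop :=
  ∀ (I : Type u) (f : I → ModuleCat.{u} R), (∀ i, f i ∈ 𝒳) →
    ModuleCat.of R (⨁ i, (f i : Type u)) ∈ 𝒳

/-- `𝒳` is closed under direct summands. -/
def ClosedUnderSummands (𝒳 : Set (ModuleCat.{u} R)) : Prop :=
  ∀ (M N : ModuleCat.{u} R) (s : M ⟶ N) (r : N ⟶ M), s ≫ r = 𝟙 M → N ∈ 𝒳 → M ∈ 𝒳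

/-- In positive degrees, vanishing of `Ext` defined by derived functors agrees with vanishing of
`Ext` defined through the derived category. -/
lemma extZero_succ_iff (M N : ModuleCat.{u} R) (n : ℕ) :
    ExtZero M N (n + 1) ↔ ∀ e : Abelian.Ext M N (n + 1), e = 0 := by
  have S : ProjectiveResolution M := ProjectiveResolution.of M
  have key : ExtZero M N (n + 1) ↔ ∀ f : S.complex.X (n + 1) ⟶ N,
      S.complex.d (n + 2) (n + 1) ≫ f = 0 →
        ∃ g : S.complex.X n ⟶ N, S.complex.d (n + 1) n ≫ g = f := by
    rw [ExtZero, (S.isoExt (n + 1) N).isZero_iff, ← HomologicalComplex.exactAt_iff_isZero_homology,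
      HomologicalComplex.exactAt_iff' _ n (n + 1) (n + 2) (by simp) (by simp),
      ShortComplex.moduleCat_exact_iff]
    exact Iff.rfl
  rw [key]
  constructor
  · intro h e
    obtain ⟨f, hf, rfl⟩ := S.extMk_surjective e (n + 2) rfl
    exact (S.extMk_eq_zero_iff f (n + 2) rfl hf n rfl).2 (h f hf)
  · intro h f hf
    exact (S.extMk_eq_zero_iff f (n + 2) rfl hf n rfl).1 (h _)

lemma IsSES.extZero_X₃ {K X M : ModuleCat.{u} R} {f : K ⟶ X} {g : X ⟶ M} (h : IsSES f g)
    {N : ModuleCat.{u} R} {n : ℕ} (hK : ExtZero K N (n + 1)) (hX : ExtZero X N (n + 2)) :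
    ExtZero M N (n + 2) := by
  obtain ⟨w, hS⟩ := h
  rw [extZero_succ_iff] at *
  intro e
  obtain ⟨x, rfl⟩ := Abelian.Ext.contravariant_sequence_exact₃ hS N e (hX _)
    (n₀ := n + 1) (by omega)
  rw [hK x, Abelian.Ext.comp_zero]

lemma IsSES.extZero_X₁ {K X M : ModuleCat.{u} R} {f : K ⟶ X} {g : X ⟶ M} (h : IsSES f g)
    {N : ModuleCat.{u} R} {n : ℕ} (hX : ExtZero X N (n + 1)) (hM : ExtZero M N (n + 2)) :
    ExtZero K N (n + 1) := by
  obtain ⟨w, hS⟩ := h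
  rw [extZero_succ_iff] at *
  intro e
  obtain ⟨x, rfl⟩ := Abelian.Ext.contravariant_sequence_exact₁ hS N e
    (n₁ := n + 2) (by omega) (hM _)
  rw [hX x, Abelian.Ext.comp_zero]

lemma IsSES.extZero_covariant_X₃ {K X N : ModuleCat.{u} R} {f : K ⟶ X} {g : X ⟶ N}
    (h : IsSES f g) {M : ModuleCat.{u} R} {n : ℕ} (hX : ExtZero M X (n + 1))
    (hK : ExtZero M K (n + 2)) : ExtZero M N (n + 1) := by
  obtain ⟨w, hS⟩ := h
  rw [extZero_succ_iff] at *
  intro e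
  obtain ⟨x, rfl⟩ := Abelian.Ext.covariant_sequence_exact₃ M hS e
    (n₁ := n + 2) rfl (hK _)
  rw [hX x, Abelian.Ext.zero_comp]

lemma exists_projective_isSES (M : ModuleCat.{u} R) :
    ∃ (K Q : ModuleCat.{u} R) (f : K ⟶ Q) (g : Q ⟶ M), Projective Q ∧ IsSES f g :=
  ⟨kernel (Projective.π M), Projective.over M, kernel.ι _, Projective.π M, inferInstance,
    kernel.condition _, { exact := ShortComplex.exact_kernel _ }⟩

lemma IsCotorsionPair.mem_of_projective {𝒜 ℬ : Set (ModuleCat.{u} R)}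
    (hcp : IsCotorsionPair 𝒜 ℬ) (Q : ModuleCat.{u} R) [Projective Q] : Q ∈ 𝒜 :=
  (hcp.1 Q).2 fun B _ ↦ isZero_Ext_succ_of_projective Q B 0

lemma rpd_le_iff {𝒳 : Set (ModuleCat.{u} R)} {M : ModuleCat.{u} R} {n : ℕ∞} :
    rpd 𝒳 M ≤ n ↔ ∀ j : ℕ, n < (j : ℕ∞) → ∀ X ∈ 𝒳, ExtZero M X j := by
  refine ⟨fun h j hj ↦ ?_, fun h ↦ sInf_le h⟩
  exact csInf_mem (s := {n : ℕ∞ | ∀ j : ℕ, n < (j : ℕ∞) → ∀ X ∈ 𝒳, ExtZero M X j})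
    ⟨⊤, fun j hj ↦ absurd hj not_top_lt⟩ j (h.trans_lt hj)

/-- A module whose higher `Ext` into `ℬ` vanishes beyond degree `n` has an `𝒜`-resolution of
length `n`. -/
lemma IsCotorsionPair.hasResLen {𝒜 ℬ : Set (ModuleCat.{u} R)} (hcp : IsCotorsionPair 𝒜 ℬ)
    (n : ℕ) {M : ModuleCat.{u} R} (hM : ∀ B ∈ ℬ, ExtZero M B (n + 1)) : HasResLen 𝒜 n M := by
  induction n generalizing M with
  | zero => exact (hcp.1 M).2 hM
  | succ n ih =>
    obtain ⟨K, Q, f, g, hQ, hfg⟩ := exists_projective_isSES M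
    exact ⟨K, Q, f, g, hcp.mem_of_projective Q, hfg,
      ih fun B hB ↦ hfg.extZero_X₁ (isZero_Ext_succ_of_projective Q B n) (hM B hB)⟩

lemma IsCotorsionPair.resdim_le_pd {𝒜 ℬ : Set (ModuleCat.{u} R)} (hcp : IsCotorsionPair 𝒜 ℬ)
    (M : ModuleCat.{u} R) : resdim 𝒜 M ≤ pd M := by
  induction h : pd M with
  | top => exact le_top
  | coe n =>
    have hM := rpd_le_iff.1 h.le (n + 1) (by exact_mod_cast n.lt_succ_self)
    exact iInf_le (fun n : {n : ℕ // HasResLen 𝒜 n M} ↦ ((n : ℕ) : ℕ∞))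
      ⟨n, hcp.hasResLen n fun B _ ↦ hM B trivial⟩

/-- Dimension shifting along an `𝒳`-resolution. -/
lemma rpd_le_of_hasResLen {𝒳 𝒴 : Set (ModuleCat.{u} R)} {m : ℕ} {M : ModuleCat.{u} R}
    (hM : HasResLen 𝒳 m M) : rpd 𝒴 M ≤ rpdClass 𝒴 𝒳 + m := by
  induction m generalizing M with
  | zero =>
    rw [Nat.cast_zero, add_zero]
    exact le_iSup (fun X : 𝒳 ↦ rpd 𝒴 X) ⟨M, hM⟩
  | succ m ih =>
    obtain ⟨K, X, f, g, hX, hfg, hK⟩ := hM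
    rw [rpd_le_iff]
    intro j hj Y hY
    induction hd : rpdClass 𝒴 𝒳 with
    | top => simp [hd] at hj
    | coe d =>
    have hXd : rpd 𝒴 X ≤ d := hd ▸ le_iSup (fun X : 𝒳 ↦ rpd 𝒴 X) ⟨X, hX⟩
    have hKd := ih hK
    rw [hd] at hj hKd
    norm_cast at hj
    obtain ⟨i, rfl⟩ : ∃ i, j = i + 2 := ⟨j - 2, by omega⟩
    exact hfg.extZero_X₃ (rpd_le_iff.1 hKd _ (by norm_cast; omega) Y hY)
      (rpd_le_iff.1 hXd _ (by norm_cast; omega) Y hY)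

/-- The finite projective dimension of a module is detected by any class containing the
projectives. -/
lemma pd_le_rpd {𝒳 : Set (ModuleCat.{u} R)} (h𝒳 : ∀ Q : ModuleCat.{u} R, Projective Q → Q ∈ 𝒳)
    {M : ModuleCat.{u} R} (hM : pd M < ⊤) : pd M ≤ rpd 𝒳 M := by
  obtain ⟨n, hn⟩ := ENat.ne_top_iff_exists.1 hM.ne
  have key : ∀ k j : ℕ, n < j + k → rpd 𝒳 M < j → ∀ N : ModuleCat.{u} R, ExtZero M N j := by
    intro k
    induction k with
    | zero => exact fun j hj _ N ↦ rpd_le_iff.1 hn.ge j (by exact_mod_cast hj) N trivial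
    | succ k ih =>
      intro j hj hj' N
      obtain ⟨i, rfl⟩ : ∃ i, j = i + 1 :=
        Nat.exists_eq_succ_of_ne_zero (by rintro rfl; simp at hj')
      obtain ⟨K, Q, f, g, hQ, hfg⟩ := exists_projective_isSES N
      exact hfg.extZero_covariant_X₃ (rpd_le_iff.1 le_rfl _ hj' Q (h𝒳 Q hQ))
        (ih (i + 2) (by omega) (hj'.trans (by norm_cast; omega)) K)
  exact rpd_le_iff.2 fun j hj N _ ↦ key (n + 1) j (by omega) hj N

/-- Theorem 4.2(a): `α ≤ Findim(R) ≤ pd_𝒜(𝒜) + α` where `α = resdim_𝒜(𝒫)`. -/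
theorem stmt0 {R : Type u} [Ring R] (𝒜 ℬ : Set (ModuleCat.{u} R))
    (hcp : IsCotorsionPair 𝒜 ℬ) (hcomp : IsComplete 𝒜 ℬ) (hher : IsHereditary 𝒜 ℬ)
    (hpd : rpdClass 𝒜 𝒜 < ⊤) :
    resdimClass 𝒜 (P R) ≤ bigFindim R ∧
      bigFindim R ≤ rpdClass 𝒜 𝒜 + resdimClass 𝒜 (P R) := by
  refine ⟨iSup_mono fun M ↦ hcp.resdim_le_pd M.1, iSup_le fun M ↦ ?_⟩
  refine (pd_le_rpd (fun Q _ ↦ hcp.mem_of_projective Q) M.2).trans ?_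
  refine le_trans ?_ (add_le_add_right (le_iSup (fun Y : P R ↦ resdim 𝒜 Y) M) _)
  rw [resdim, ENat.add_iInf]
  exact le_iInf fun m ↦ rpd_le_of_hasResLen m.2

end CotorsionDim
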